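/- Let u < w in the composition poset ℙ*. Then Σ_{v : u ≤ v ≤ w} Σ_η (−1)^{d(η)} = 0, where the inner sum ranges over all normal embeddings η of v into w. (Equivalently, there is a sign-reversing, fixed-point-free involution on the set of all normal embeddings into w of elements v of the interval [u,w].) -/

import Mathlib

/-!
Sagan–Vatter, sign-reversing involution step: for `u < w` in the composition
poset ℙ*, the signed count of normal embeddings into `w` of elements of the
interval `[u,w]` vanishes.
-/

/-- The underlying word of a composition, as a list of natural numbers. -/
def coes (w : List ℕ+) : List ℕ := w.map (fun x => (x : ℕ))

/-- The order on the composition poset ℙ*: `u ≤ w` iff `w` has a subsequence of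
length `|u|` dominating `u` entrywise. -/
def CompLE (u w : List ℕ+) : Prop := List.SublistForall₂ (· ≤ ·) u w

/-- `η` is an embedding of the composition `u` into the word `W` over ℕ. -/
def IsEmb (u : List ℕ+) (W η : List ℕ) : Prop :=
  η.length = W.length ∧
  η.filter (fun x => decide (x ≠ 0)) = coes u ∧
  ∀ i, η.getD i 0 ≤ W.getD i 0

/-- `[r,t]` is a run of `k`'s in the word `W`. -/
def IsRun (W : List ℕ) (k r t : ℕ) : Prop :=
  r ≤ t ∧ t < W.length ∧ (∀ i, r ≤ i → i ≤ t → W.getD i 0 = k) ∧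
  (r = 0 ∨ W.getD (r - 1) 0 ≠ k) ∧ (t + 1 = W.length ∨ W.getD (t + 1) 0 ≠ k)

/-- A normal embedding of `u` into the word `W`. -/
def NormalEmb (u : List ℕ+) (W η : List ℕ) : Prop :=
  IsEmb u W η ∧
  (∀ i, i < W.length →
    η.getD i 0 = W.getD i 0 ∨ η.getD i 0 = W.getD i 0 - 1 ∨ η.getD i 0 = 0) ∧
  ∀ k r t, IsRun W k r t →
    (k = 1 → ∀ i, r < i → i ≤ t → η.getD i 0 ≠ 0) ∧
    (2 ≤ k → η.getD r 0 ≠ 0)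

/-- The defect of an embedding `η` into `W`: the number of positions `i` with
`η(i) = W(i) - 1`. -/
def defect (W η : List ℕ) : ℕ :=
  (List.range W.length).countP (fun i => decide (η.getD i 0 = W.getD i 0 - 1))

/-- The entries a normal embedding may take at a position with letter `k` preceded by letter `p`
(`p = 0` at the beginning of the word). -/
def normalEntries (p k : ℕ) : Finset ℕ :=
  if k = p then (if k = 1 then {1} else {k, k - 1, 0}) else {k, k - 1}

/-- The normal embeddings into a word preceded by the letter `p`. -/
def normalWords : ℕ → List ℕ+ → Finset (List ℕ)
  | _, [] => {[]}
  | p, k :: w => Finset.image₂ List.cons (normalEntries p k) (normalWords k w)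

/-- The composition formed by the nonzero entries of a word. -/
def nonzeroPart : List ℕ → List ℕ+
  | [] => []
  | 0 :: η => nonzeroPart η
  | (n + 1) :: η => n.succPNat :: nonzeroPart η

/-- What remains of `u` to be matched after greedily reading the entry `x`. -/
def greedyStep : List ℕ+ → ℕ → List ℕ+
  | [], _ => []
  | a :: u, x => if (a : ℕ) ≤ x then u else a :: u

/-- The indicator of the words obtained from `w` by deleting some of its leading `p`'s. -/
def leadingDeletions (p : ℕ) : List ℕ+ → List ℕ+ → ℤ
  | [], u => if u = [] then 1 else 0
  | k :: w, u => (if u = k :: w then 1 else 0) + if (k : ℕ) = p then leadingDeletions p w u else 0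

open Classical in
/-- The signed count of normal embeddings into `w`, preceded by `p`, of compositions above `u`. -/
noncomputable def signedCount (p : ℕ) (w u : List ℕ+) : ℤ :=
  ∑ η ∈ normalWords p w, if CompLE u (nonzeroPart η) then (-1 : ℤ) ^ defect (coes w) η else 0

theorem coes_cons (k : ℕ+) (w : List ℕ+) : coes (k :: w) = (k : ℕ) :: coes w := rfl

theorem coes_eq_map (w : List ℕ+) : coes w = w.map PNat.val := by
  induction w with
  | nil => rfl
  | cons k w ih => rw [coes_cons, ih, List.map_cons]

theorem coes_injective : Function.Injective coes := by
  rw [show coes = List.map PNat.val from funext coes_eq_map]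
  exact List.map_injective_iff.mpr PNat.coe_injective

theorem coes_nonzeroPart (η : List ℕ) :
    coes (nonzeroPart η) = η.filter (fun x => decide (x ≠ 0)) := by
  fun_induction nonzeroPart η with
  | case1 => rfl
  | case2 η ih => simpa using ih
  | case3 n η ih => simpa [coes_cons] using ih

theorem filter_eq_coes_iff (η : List ℕ) (v : List ℕ+) :
    η.filter (fun x => decide (x ≠ 0)) = coes v ↔ nonzeroPart η = v := by
  rw [← coes_nonzeroPart, coes_injective.eq_iff]

theorem defect_cons (k x : ℕ) (W η : List ℕ) :
    defect (k :: W) (x :: η) = defect W η + if x = k - 1 then 1 else 0 := by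
  simp only [defect, List.length_cons, List.range_succ_eq_map, List.countP_cons, List.countP_map]
  congr 1
  simp

theorem CompLE.of_cons {a : ℕ+} {u v : List ℕ+} (h : CompLE (a :: u) v) : CompLE u v := by
  unfold CompLE at *
  induction v with
  | nil => cases h
  | cons b v ih =>
    cases h with
    | cons _ h => exact h.cons_right
    | cons_right h => exact (ih h).cons_right

theorem compLE_cons_cons (a b : ℕ+) (u v : List ℕ+) :
    CompLE (a :: u) (b :: v) ↔ if a ≤ b then CompLE u v else CompLE (a :: u) v := by
  split_ifs with hab
  · refine ⟨fun h => ?_, fun h => List.SublistForall₂.cons hab h⟩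
    cases h with
    | cons _ h => exact h
    | cons_right h => exact CompLE.of_cons h
  · refine ⟨fun h => ?_, fun h => List.SublistForall₂.cons_right h⟩
    cases h with
    | cons h _ => exact absurd h hab
    | cons_right h => exact h

theorem compLE_nonzeroPart_cons (u : List ℕ+) (x : ℕ) (η : List ℕ) :
    CompLE u (nonzeroPart (x :: η)) ↔ CompLE (greedyStep u x) (nonzeroPart η) := by
  cases u with
  | nil => exact iff_of_true .nil .nil
  | cons a u =>
    cases x with
    | zero => simp [greedyStep, nonzeroPart]
    | succ n =>
      have hle : a ≤ n.succPNat ↔ (a : ℕ) ≤ n + 1 := by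
        rw [← PNat.coe_le_coe, Nat.succPNat_coe]
      simp only [nonzeroPart, greedyStep, compLE_cons_cons, hle]
      split_ifs <;> rfl

theorem signedCount_nil (p : ℕ) (u : List ℕ+) :
    signedCount p [] u = if u = [] then 1 else 0 := by
  have h : CompLE u [] ↔ u = [] :=
    ⟨fun h => by cases h; rfl, fun h => h ▸ List.SublistForall₂.nil⟩
  rw [signedCount, normalWords, Finset.sum_singleton, nonzeroPart]
  simp only [h]
  simp [defect, coes]

theorem signedCount_cons (p : ℕ) (k : ℕ+) (w u : List ℕ+) :
    signedCount p (k :: w) u = ∑ x ∈ normalEntries p k,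
      (if x = (k : ℕ) - 1 then -1 else 1) * signedCount k w (greedyStep u x) := by
  have hinj : Set.InjOn (Function.uncurry (List.cons (α := ℕ)))
      ((normalEntries p k ×ˢ normalWords k w : Finset (ℕ × List ℕ)) : Set (ℕ × List ℕ)) := by
    rintro ⟨x, η⟩ _ ⟨y, θ⟩ _ h
    simpa using h
  rw [signedCount, normalWords, ← Finset.image_uncurry_product, Finset.sum_image hinj,
    Finset.sum_product]
  refine Finset.sum_congr rfl fun x _ => ?_
  rw [signedCount, Finset.mul_sum]
  refine Finset.sum_congr rfl fun η _ => ?_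
  by_cases hu : CompLE (greedyStep u x) (nonzeroPart η)
  · rw [Function.uncurry_apply_pair, if_pos ((compLE_nonzeroPart_cons u x η).mpr hu), if_pos hu,
      coes_cons, defect_cons]
    split_ifs <;> simp [pow_succ]
  · rw [Function.uncurry_apply_pair, if_neg (mt (compLE_nonzeroPart_cons u x η).mp hu), if_neg hu,
      mul_zero]

theorem leadingDeletions_sub_cons (k : ℕ+) (w u : List ℕ+) :
    leadingDeletions k w u - leadingDeletions k w (k :: u) = if u = w then 1 else 0 := by
  induction w with
  | nil => simp [leadingDeletions]
  | cons j w ih =>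
    by_cases hj : j = k
    · subst hj
      simp only [leadingDeletions, List.cons.injEq, true_and, if_true]
      linarith
    · have hj' : ¬ k = j := fun h => hj h.symm
      simp [leadingDeletions, hj, hj']

theorem signedCount_eq_leadingDeletions (p : ℕ) (w u : List ℕ+) :
    signedCount p w u = leadingDeletions p w u := by
  induction w generalizing p u with
  | nil => simp [signedCount_nil, leadingDeletions]
  | cons k w ih =>
    have hk := k.pos
    have hzero : greedyStep u 0 = u := by
      cases u with
      | nil => rfl
      | cons a u => simp [greedyStep]
    have hdiff : leadingDeletions k w (greedyStep u k) -
        leadingDeletions k w (greedyStep u (k - 1)) = if u = k :: w then 1 else 0 := by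
      cases u with
      | nil => simp [greedyStep]
      | cons a u =>
        rcases lt_trichotomy (a : ℕ) k with h | h | h
        · have hne : a ≠ k := by rintro rfl; exact lt_irrefl _ h
          simp [greedyStep, hne, show (a : ℕ) ≤ k by omega, show (a : ℕ) ≤ k - 1 by omega]
        · obtain rfl := PNat.coe_injective h
          simp [greedyStep, show ¬ (a : ℕ) ≤ a - 1 by omega, leadingDeletions_sub_cons]
        · have hne : a ≠ k := by rintro rfl; exact lt_irrefl _ h
          simp [greedyStep, hne, show ¬ (a : ℕ) ≤ k by omega, show ¬ (a : ℕ) ≤ k - 1 by omega]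
    rw [signedCount_cons]
    simp only [ih, leadingDeletions, ← hdiff]
    have hkk : ¬ (k : ℕ) = k - 1 := by omega
    unfold normalEntries
    split_ifs with hp h1
    · subst hp
      simp [h1, hzero]
    · subst hp
      have h0 : ¬ 0 = (k : ℕ) - 1 := by omega
      have h0' : ¬ (k : ℕ) - 1 = 0 := by omega
      rw [Finset.sum_insert (by simp [hkk]), Finset.sum_insert (by simp [h0']),
        Finset.sum_singleton]
      simp only [hkk, h0, if_false, if_true, hzero]
      ring
    · rw [Finset.sum_insert (by simp [hkk]), Finset.sum_singleton]
      simp only [hkk, if_false, if_true]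
      ring

theorem leadingDeletions_zero (w u : List ℕ+) :
    leadingDeletions 0 w u = if u = w then 1 else 0 := by
  cases w <;> simp [leadingDeletions]

theorem mem_normalEntries {p k x : ℕ} (hk : 0 < k) :
    x ∈ normalEntries p k ↔ x ≤ k ∧ (x = k ∨ x = k - 1 ∨ x = 0) ∧
      (k = p → k = 1 → x ≠ 0) ∧ (k ≠ p → 2 ≤ k → x ≠ 0) := by
  unfold normalEntries
  split_ifs <;> simp <;> omega

theorem mem_normalWords {p : ℕ} {w : List ℕ+} {η : List ℕ} :
    η ∈ normalWords p w ↔ η.length = w.length ∧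
      ∀ i < w.length, η.getD i 0 ∈ normalEntries ((p :: coes w).getD i 0) ((coes w).getD i 0) := by
  induction w generalizing p η with
  | nil => simp [normalWords]
  | cons k w ih =>
    cases η with
    | nil => simp [normalWords]
    | cons x η =>
      simp only [normalWords, Finset.mem_image₂, List.cons.injEq, List.length_cons,
        Nat.forall_lt_succ_left, coes_cons, List.getD_cons_succ, List.getD_cons_zero]
      constructor
      · rintro ⟨x, hx, η, hη, rfl, rfl⟩
        obtain ⟨h1, h2⟩ := ih.mp hη
        exact ⟨by omega, hx, h2⟩
      · rintro ⟨h1, hx, h2⟩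
        exact ⟨x, hx, η, ih.mpr ⟨by omega, h2⟩, rfl, rfl⟩

theorem compLE_of_mem_normalWords {p : ℕ} {w : List ℕ+} {η : List ℕ} (h : η ∈ normalWords p w) :
    CompLE (nonzeroPart η) w := by
  induction w generalizing p η with
  | nil =>
    obtain rfl : η = [] := by simpa [normalWords] using h
    exact .nil
  | cons k w ih =>
    obtain ⟨x, hx, η, hη, rfl⟩ := Finset.mem_image₂.mp h
    have hxk := ((mem_normalEntries k.pos).mp hx).1
    cases x with
    | zero => exact (ih hη).cons_right
    | succ n =>
      refine List.SublistForall₂.cons ?_ (ih hη)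
      rw [← PNat.coe_le_coe, Nat.succPNat_coe]
      exact hxk

theorem exists_isRun {W : List ℕ} {i : ℕ} (hi : i < W.length) :
    ∃ r t, r ≤ i ∧ i ≤ t ∧ IsRun W (W.getD i 0) r t := by
  set k := W.getD i 0 with hk
  have hleft : ∃ r ≤ i, (∀ j, r ≤ j → j ≤ i → W.getD j 0 = k) ∧
      (r = 0 ∨ W.getD (r - 1) 0 ≠ k) := by
    have hex : ∃ r, r ≤ i ∧ ∀ j, r ≤ j → j ≤ i → W.getD j 0 = k :=
      ⟨i, le_rfl, fun j h1 h2 => by rw [hk, le_antisymm h2 h1]⟩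
    classical
    obtain ⟨hle, hrun⟩ := Nat.find_spec hex
    refine ⟨Nat.find hex, hle, hrun, ?_⟩
    by_contra! hcon
    refine Nat.find_min hex (m := Nat.find hex - 1) (by omega) ⟨by omega, fun j h1 h2 => ?_⟩
    rcases eq_or_lt_of_le h1 with rfl | h1
    · exact hcon.2
    · exact hrun j (by omega) h2
  have hright : ∃ t, i ≤ t ∧ t < W.length ∧ (∀ j, i ≤ j → j ≤ t → W.getD j 0 = k) ∧
      (t + 1 = W.length ∨ W.getD (t + 1) 0 ≠ k) := by
    have hex : ∃ t, i ≤ t ∧ (t + 1 = W.length ∨ W.getD (t + 1) 0 ≠ k) :=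
      ⟨W.length - 1, by omega, Or.inl (by omega)⟩
    classical
    obtain ⟨hle, hend⟩ := Nat.find_spec hex
    have hmin : Nat.find hex ≤ W.length - 1 := Nat.find_min' hex ⟨by omega, Or.inl (by omega)⟩
    refine ⟨Nat.find hex, hle, by omega, fun j h1 h2 => ?_, hend⟩
    rcases eq_or_lt_of_le h1 with rfl | h1
    · rfl
    · have := Nat.find_min hex (m := j - 1) (by omega)
      by_contra hj
      exact this ⟨by omega, Or.inr (by rwa [Nat.sub_add_cancel (by omega)])⟩
  obtain ⟨r, hr, hrun, hstart⟩ := hleft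
  obtain ⟨t, ht, htl, hrun', hend⟩ := hright
  refine ⟨r, t, hr, ht, by omega, htl, fun j h1 h2 => ?_, hstart, hend⟩
  rcases le_total j i with h | h
  · exact hrun j h1 h
  · exact hrun' j h h2

theorem normalEmb_iff (v w : List ℕ+) (η : List ℕ) :
    NormalEmb v (coes w) η ↔ η ∈ normalWords 0 w ∧ nonzeroPart η = v := by
  have hlen : (coes w).length = w.length := by simp [coes_eq_map]
  have hpos : ∀ i < w.length, 0 < (coes w).getD i 0 := by
    intro i hi
    simp [coes_eq_map, hi]
  have hprev : ∀ i, 0 < i → (0 :: coes w).getD i 0 = (coes w).getD (i - 1) 0 := by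
    intro i hi
    obtain ⟨j, rfl⟩ := Nat.exists_eq_succ_of_ne_zero hi.ne'
    simp
  rw [mem_normalWords, NormalEmb, IsEmb, filter_eq_coes_iff, hlen]
  constructor
  · rintro ⟨⟨hl, hv, hle⟩, hval, hrun⟩
    refine ⟨⟨hl, fun i hi => (mem_normalEntries (hpos i hi)).mpr ⟨hle i, hval i hi, ?_, ?_⟩⟩, hv⟩
    · intro hp h1
      obtain ⟨r, t, hr, ht, hR⟩ := exists_isRun (hlen ▸ hi)
      refine (hrun _ r t hR).1 h1 i (lt_of_le_of_ne hr ?_) ht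
      rintro rfl
      have := hpos r hi
      rcases Nat.eq_zero_or_pos r with rfl | h0
      · simp only [List.getD_cons_zero] at hp
        omega
      · rw [hprev r h0] at hp
        exact hR.2.2.2.1.elim (by omega) (fun h => h hp.symm)
    · intro hp h2
      obtain ⟨r, t, hr, ht, hR⟩ := exists_isRun (hlen ▸ hi)
      have hri : r = i := by
        by_contra hne
        rw [hprev i (by omega)] at hp
        exact hp (hR.2.2.1 (i - 1) (by omega) (by omega)).symm
      exact hri ▸ (hrun _ r t hR).2 h2
  · rintro ⟨⟨hl, hmem⟩, hv⟩
    have hloc := fun i hi => (mem_normalEntries (hpos i hi)).mp (hmem i hi)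
    refine ⟨⟨hl, hv, fun i => ?_⟩, fun i hi => (hloc i hi).2.1, ?_⟩
    · rcases lt_or_ge i w.length with hi | hi
      · exact (hloc i hi).1
      · rw [List.getD_eq_default _ _ (hl ▸ hi)]
        exact Nat.zero_le _
    · rintro k r t ⟨hrt, htl, hR, hstart, -⟩
      rw [hlen] at htl
      refine ⟨fun hk i hri hit => ?_, fun hk => ?_⟩
      · refine (hloc i (by omega)).2.2.1 ?_ ((hR i hri.le hit).trans hk)
        rw [hprev i (by omega), hR i hri.le hit, hR (i - 1) (by omega) (by omega)]
      · have hr := hR r le_rfl hrt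
        refine (hloc r (by omega)).2.2.2 ?_ (hr.symm ▸ hk)
        rw [hr]
        rcases Nat.eq_zero_or_pos r with rfl | h0
        · simp only [List.getD_cons_zero]
          omega
        · rw [hprev r h0]
          exact (hstart.resolve_left h0.ne').symm

/-- For `u < w` in ℙ*, summing the signs `(-1)^{d(η)}` over all normal
embeddings `η` into `w` of all `v` in the interval `[u,w]` gives `0`. -/
theorem sum_normal_embeddings_eq_zero
    (u w : List ℕ+) (h : CompLE u w) (hne : u ≠ w) :
    (∑ᶠ v ∈ {v : List ℕ+ | CompLE u v ∧ CompLE v w},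
      ∑ᶠ η ∈ {η : List ℕ | NormalEmb v (coes w) η},
        (-1 : ℤ) ^ defect (coes w) η) = 0 := by
  classical
  have hinner : ∀ v, (∑ᶠ η ∈ {η : List ℕ | NormalEmb v (coes w) η},
      (-1 : ℤ) ^ defect (coes w) η) =
      ∑ η ∈ normalWords 0 w, if nonzeroPart η = v then (-1 : ℤ) ^ defect (coes w) η else 0 := by
    intro v
    have hset : {η : List ℕ | NormalEmb v (coes w) η} =
        ((normalWords 0 w).filter (fun η => nonzeroPart η = v) : Finset (List ℕ)) := by
      ext η
      simp [normalEmb_iff]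
    rw [hset, finsum_mem_coe_finset, Finset.sum_filter]
  simp only [hinner, finsum_mem_def]
  rw [finsum_eq_sum_of_support_subset (s := (normalWords 0 w).image nonzeroPart)]
  · have hswap : signedCount 0 w u = 0 := by
      rw [signedCount_eq_leadingDeletions, leadingDeletions_zero, if_neg hne]
    have hite : ∀ v, {v : List ℕ+ | CompLE u v ∧ CompLE v w}.indicator (fun v =>
        ∑ η ∈ normalWords 0 w,
          if nonzeroPart η = v then (-1 : ℤ) ^ defect (coes w) η else 0) v =
        ∑ η ∈ normalWords 0 w, if nonzeroPart η = v then
          (if CompLE u (nonzeroPart η) then (-1 : ℤ) ^ defect (coes w) η else 0) else 0 := by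
      intro v
      rw [Set.indicator_apply]
      split_ifs with hv
      · refine Finset.sum_congr rfl fun η _ => ?_
        split_ifs with h1 h2
        · rfl
        · exact absurd (h1 ▸ hv.1) h2
        · rfl
      · refine (Finset.sum_eq_zero fun η hη => ?_).symm
        split_ifs with h1 h2
        · exact absurd ⟨h1 ▸ h2, h1 ▸ compLE_of_mem_normalWords hη⟩ hv
        · rfl
        · rfl
    refine Eq.trans ?_ hswap
    rw [signedCount]
    simp only [Set.indicator_apply] at hite ⊢
    rw [Finset.sum_congr rfl fun v _ => hite v, Finset.sum_comm]
    refine Finset.sum_congr rfl fun η hη => ?_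
    rw [Finset.sum_ite_eq, if_pos (Finset.mem_image_of_mem _ hη)]
  · intro v hv
    by_contra hcon
    refine hv ?_
    rw [Set.indicator_apply]
    split_ifs
    · refine Finset.sum_eq_zero fun η hη => if_neg ?_
      rintro rfl
      exact hcon (Finset.mem_coe.mpr (Finset.mem_image_of_mem _ hη))
    · rfl
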